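/- Let p₁(·), p₂(·) : ℝⁿ → [1,∞) be measurable exponents with pⱼ(·) ∈ LH for j = 1,2, and define p(·) by 1/p(x) = 1/p₁(x) + 1/p₂(x). For a family 𝒬 of pairwise disjoint cubes, define the bilinear p(·)-averaging operator T⃗_{p⃗(·),𝒬}(f₁,f₂)(x) = Σ_{Q∈𝒬} (‖f₁χ_Q‖_{p₁(·)}‖f₂χ_Q‖_{p₂(·)}/‖χ_Q‖_{p(·)})·χ_Q(x). Then there is a constant C independent of 𝒬 such that ‖T⃗_{p⃗(·),𝒬}(f₁,f₂)‖_{p(·)} ≤ C‖f₁‖_{p₁(·)}‖f₂‖_{p₂(·)} for all f₁ ∈ L^{p₁(·)} and f₂ ∈ L^{p₂(·)}. -/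

import Mathlib

open MeasureTheory ENNReal Set

noncomputable section

/-- Euclidean space `ℝⁿ`. -/
abbrev Rn (n : ℕ) : Type := Fin n → ℝ

/-- A cube in `ℝⁿ` with sides parallel to the coordinate axes. -/
structure Cube (n : ℕ) : Type where
  base : Fin n → ℝ
  side : ℝ
  side_pos : 0 < side

namespace Cube

/-- The set of points of a cube. -/
def toSet {n : ℕ} (Q : Cube n) : Set (Rn n) :=
  {x | ∀ i, Q.base i ≤ x i ∧ x i < Q.base i + Q.side}

/-- The volume `|Q|` of a cube. -/
def vol {n : ℕ} (Q : Cube n) : ℝ≥0∞ := ENNReal.ofReal (Q.side ^ n)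

/-- Membership in the standard dyadic grid `𝒟₀`. -/
def IsDyadic {n : ℕ} (Q : Cube n) : Prop :=
  ∃ (k : ℤ) (j : Fin n → ℤ), Q.side = (2 : ℝ) ^ (-k) ∧
    ∀ i, Q.base i = (2 : ℝ) ^ (-k) * (j i : ℝ)

end Cube

/-- The modular associated to an extended-real-valued exponent `r(·)`:
`ρ(f/λ) = ∫_{r ≠ ∞} (f/λ)^{r(x)} dμ + ‖f/λ‖_{L^∞({r = ∞})}`. -/
def eModular {n : ℕ} (r : Rn n → ℝ≥0∞) (μ : Measure (Rn n)) (f : Rn n → ℝ≥0∞)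
    (lam : ℝ≥0∞) : ℝ≥0∞ :=
  (∫⁻ x in {x | r x ≠ ∞}, (f x / lam) ^ (r x).toReal ∂μ)
    + essSup (fun x => f x / lam) (μ.restrict {x | r x = ∞})

/-- The variable Lebesgue (quasi)norm `‖f‖_{r(·)}` with respect to a measure `μ`. -/
def eNorm {n : ℕ} (r : Rn n → ℝ≥0∞) (μ : Measure (Rn n)) (f : Rn n → ℝ≥0∞) : ℝ≥0∞ :=
  sInf {lam : ℝ≥0∞ | lam ≠ 0 ∧ eModular r μ f lam ≤ 1}

/-- The variable Lebesgue norm of a real-valued function with respect to Lebesgue measure. -/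
def vNorm {n : ℕ} (r : Rn n → ℝ≥0∞) (f : Rn n → ℝ) : ℝ≥0∞ :=
  eNorm r volume fun x => ENNReal.ofReal |f x|

/-- View a real-valued exponent as an extended-real-valued one. -/
def ofExp {n : ℕ} (p : Rn n → ℝ) : Rn n → ℝ≥0∞ := fun x => ENNReal.ofReal (p x)

/-- The conjugate of an extended real exponent: `1/t + 1/t' = 1`. -/
def econj (t : ℝ≥0∞) : ℝ≥0∞ :=
  if t = 1 then ∞ else if t = ∞ then 1 else ENNReal.ofReal (t.toReal / (t.toReal - 1))

/-- The pointwise conjugate exponent `p'(·)` of a real-valued exponent. -/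
def conjExp {n : ℕ} (p : Rn n → ℝ) : Rn n → ℝ≥0∞ := fun x => econj (ENNReal.ofReal (p x))

/-- A weight: a measurable function that is positive (and finite) a.e. -/
def IsWeight {n : ℕ} (w : Rn n → ℝ) : Prop :=
  Measurable w ∧ ∀ᵐ x ∂(volume : Measure (Rn n)), 0 < w x

/-- Local log-Hölder continuity `LH₀`. -/
def LH0 {n : ℕ} (p : Rn n → ℝ) : Prop :=
  ∃ C₀ > 0, ∀ x y : Rn n, dist x y < 1 / 2 →
    |1 / p x - 1 / p y| ≤ C₀ / (-Real.log (dist x y))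

/-- Log-Hölder continuity at infinity with a given asymptotic value `pinf`. -/
def LHinfWith {n : ℕ} (p : Rn n → ℝ) (pinf : ℝ) : Prop :=
  ∃ C > 0, ∀ x : Rn n, |1 / p x - 1 / pinf| ≤ C / Real.log (Real.exp 1 + ‖x‖)

/-- Log-Hölder continuity at infinity `LH∞`. -/
def LHinf {n : ℕ} (p : Rn n → ℝ) : Prop := ∃ pinf > 0, LHinfWith p pinf

/-- Log-Hölder continuity `LH = LH₀ ∩ LH∞`. -/
def LH {n : ℕ} (p : Rn n → ℝ) : Prop := LH0 p ∧ LHinf p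

/-- The bilinear variable Muckenhoupt condition `(w₁,w₂,w) ∈ A_{p⃗(·)}`. -/
def ApVec {n : ℕ} (p₁ p₂ p w₁ w₂ w : Rn n → ℝ) : Prop :=
  ∃ C : ℝ≥0∞, C ≠ ∞ ∧ ∀ Q : Cube n,
    Q.vol⁻¹ ^ 2 * vNorm (ofExp p) (Q.toSet.indicator w) *
      vNorm (conjExp p₁) (Q.toSet.indicator fun x => (w₁ x)⁻¹) *
      vNorm (conjExp p₂) (Q.toSet.indicator fun x => (w₂ x)⁻¹) ≤ C

/-- The variable Muckenhoupt class `A_{r(·)}` for an extended-real-valued exponent. -/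
def ApVarE {n : ℕ} (r : Rn n → ℝ≥0∞) (v : Rn n → ℝ) : Prop :=
  ∃ C : ℝ≥0∞, C ≠ ∞ ∧ ∀ Q : Cube n,
    Q.vol⁻¹ * vNorm r (Q.toSet.indicator v) *
      vNorm (fun x => econj (r x)) (Q.toSet.indicator fun x => (v x)⁻¹) ≤ C

/-- The bilinear maximal operator `M(f₁,f₂)`. -/
def biMax {n : ℕ} (f₁ f₂ : Rn n → ℝ) (x : Rn n) : ℝ≥0∞ :=
  ⨆ (Q : Cube n) (_ : x ∈ Q.toSet),
    (Q.vol⁻¹ * ∫⁻ y in Q.toSet, ENNReal.ofReal |f₁ y|) *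
      (Q.vol⁻¹ * ∫⁻ y in Q.toSet, ENNReal.ofReal |f₂ y|)

/-- The dyadic bilinear maximal operator `M^d(f₁,f₂)`. -/
def biMaxD {n : ℕ} (f₁ f₂ : Rn n → ℝ) (x : Rn n) : ℝ≥0∞ :=
  ⨆ (Q : Cube n) (_ : Q.IsDyadic) (_ : x ∈ Q.toSet),
    (Q.vol⁻¹ * ∫⁻ y in Q.toSet, ENNReal.ofReal |f₁ y|) *
      (Q.vol⁻¹ * ∫⁻ y in Q.toSet, ENNReal.ofReal |f₂ y|)

/-- The bilinear averaging operator `A_Q(f₁,f₂) = (⨍_Q f₁)(⨍_Q f₂)χ_Q`. -/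
def avgOp {n : ℕ} (Q : Cube n) (f₁ f₂ : Rn n → ℝ) (x : Rn n) : ℝ≥0∞ :=
  Q.toSet.indicator
    (fun _ =>
      (Q.vol⁻¹ * ∫⁻ y in Q.toSet, ENNReal.ofReal |f₁ y|) *
        (Q.vol⁻¹ * ∫⁻ y in Q.toSet, ENNReal.ofReal |f₂ y|)) x

/-- `(p)₋(Q)`, the essential infimum of `p` on a cube `Q`. -/
def pMinusOn {n : ℕ} (p : Rn n → ℝ) (Q : Cube n) : ℝ :=
  essInf p (volume.restrict Q.toSet)

/-- The exponent `q(Q)` with `1/q(Q) = 1/(p₁)₋(Q) + 1/(p₂)₋(Q)`. -/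
def qExp {n : ℕ} (p₁ p₂ : Rn n → ℝ) (Q : Cube n) : ℝ :=
  ((pMinusOn p₁ Q)⁻¹ + (pMinusOn p₂ Q)⁻¹)⁻¹

namespace Cube

lemma toSet_eq_pi {n : ℕ} (Q : Cube n) :
    Q.toSet = Set.pi univ fun i => Ico (Q.base i) (Q.base i + Q.side) := by
  ext x; simp [toSet]

lemma measurableSet_toSet {n : ℕ} (Q : Cube n) : MeasurableSet Q.toSet := by
  rw [toSet_eq_pi]
  exact MeasurableSet.univ_pi fun _ => measurableSet_Ico

lemma volume_toSet {n : ℕ} (Q : Cube n) : volume Q.toSet = ENNReal.ofReal (Q.side ^ n) := by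
  rw [toSet_eq_pi, Real.volume_pi_Ico]
  simp [ENNReal.ofReal_pow Q.side_pos.le]

lemma volume_toSet_pos {n : ℕ} (Q : Cube n) : 0 < volume Q.toSet := by
  rw [volume_toSet]
  exact ENNReal.ofReal_pos.2 (pow_pos Q.side_pos n)

lemma dist_le_side {n : ℕ} (Q : Cube n) {x y : Rn n} (hx : x ∈ Q.toSet) (hy : y ∈ Q.toSet) :
    dist x y ≤ Q.side := by
  refine (dist_pi_le_iff Q.side_pos.le).2 fun i => ?_
  rw [Real.dist_eq, abs_le]
  constructor <;> linarith [(hx i).1, (hx i).2, (hy i).1, (hy i).2]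

/-- The mass of the integrable weight `(1 + ‖x‖) ^ (-(n + 1))` on a cube. -/
def tailMass {n : ℕ} (Q : Cube n) : ℝ≥0∞ :=
  ∫⁻ x in Q.toSet, ENNReal.ofReal ((1 + ‖x‖) ^ (-((n : ℝ) + 1)))

/-- A point of a cube lies in a subcube of side at most one. -/
lemma exists_subcube {n : ℕ} (Q : Cube n) {x : Rn n} (hx : x ∈ Q.toSet) :
    ∃ R : Cube n, R.side = min 1 Q.side ∧ x ∈ R.toSet ∧ R.toSet ⊆ Q.toSet := by
  have h1 : min 1 Q.side ≤ Q.side := min_le_right _ _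
  have h0 : 0 < min 1 Q.side := lt_min one_pos Q.side_pos
  refine ⟨⟨fun i => min (x i) (Q.base i + Q.side - min 1 Q.side), min 1 Q.side, h0⟩, rfl,
    fun i => ⟨min_le_left _ _, ?_⟩, fun y hy i => ?_⟩
  · rcases min_cases (x i) (Q.base i + Q.side - min 1 Q.side) with h | h
    · simp only [h.1]; linarith
    · simp only [h.1]; linarith [(hx i).2]
  · have hy' := hy i
    simp only at hy'
    rcases min_cases (x i) (Q.base i + Q.side - min 1 Q.side) with h | h
    · rw [h.1] at hy'
      exact ⟨by linarith [(hx i).1], by linarith⟩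
    · rw [h.1] at hy'
      exact ⟨by linarith, by linarith⟩

lemma le_tailMass {n : ℕ} (Q : Cube n) {x : Rn n} (hx : x ∈ Q.toSet) :
    ENNReal.ofReal ((min 1 Q.side) ^ n * (Real.exp 1 + ‖x‖) ^ (-((n : ℝ) + 1))) ≤
      Q.tailMass := by
  obtain ⟨R, hR, hxR, hRQ⟩ := Q.exists_subcube hx
  have h0 : 0 < min 1 Q.side := lt_min one_pos Q.side_pos
  calc ENNReal.ofReal ((min 1 Q.side) ^ n * (Real.exp 1 + ‖x‖) ^ (-((n : ℝ) + 1)))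
      = ENNReal.ofReal ((Real.exp 1 + ‖x‖) ^ (-((n : ℝ) + 1))) * volume R.toSet := by
        rw [R.volume_toSet, hR, mul_comm, ENNReal.ofReal_mul (by positivity)]
    _ = ∫⁻ _ in R.toSet, ENNReal.ofReal ((Real.exp 1 + ‖x‖) ^ (-((n : ℝ) + 1))) := by
        rw [setLIntegral_const]
    _ ≤ ∫⁻ y in R.toSet, ENNReal.ofReal ((1 + ‖y‖) ^ (-((n : ℝ) + 1))) := by
        refine setLIntegral_mono' R.measurableSet_toSet fun y hy => ?_
        refine ENNReal.ofReal_le_ofReal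
          (Real.rpow_le_rpow_of_nonpos (by positivity) ?_ (by linarith [n.cast_nonneg (α := ℝ)]))
        have h1 : dist y x ≤ 1 := (R.dist_le_side hy hxR).trans (hR ▸ min_le_left _ _)
        have h2 : ‖y‖ ≤ ‖x‖ + 1 := by
          rw [dist_eq_norm] at h1
          linarith [norm_sub_norm_le y x]
        linarith [Real.add_one_le_exp 1]
    _ ≤ Q.tailMass := lintegral_mono_set hRQ

/-- Disjoint families of cubes are countable. -/
lemma countable_of_pairwiseDisjoint {n : ℕ} {𝒬 : Set (Cube n)}
    (h𝒬 : 𝒬.PairwiseDisjoint fun Q => Q.toSet) : Countable 𝒬 := by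
  have := Measure.countable_meas_pos_of_disjoint_iUnion (μ := (volume : Measure (Rn n)))
    (As := fun Q : 𝒬 => (Q : Cube n).toSet) (fun Q => Q.1.measurableSet_toSet)
    (fun Q R hQR => h𝒬 Q.2 R.2 (Subtype.coe_ne_coe.2 hQR))
  have h : {Q : 𝒬 | 0 < volume (Q : Cube n).toSet} = univ :=
    eq_univ_of_forall fun Q => Q.1.volume_toSet_pos
  rw [h] at this
  exact countable_univ_iff.1 this

lemma tsum_setLIntegral_le {n : ℕ} {𝒬 : Set (Cube n)}
    (h𝒬 : 𝒬.PairwiseDisjoint fun Q => Q.toSet) (g : Rn n → ℝ≥0∞) :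
    ∑' Q : 𝒬, ∫⁻ x in (Q : Cube n).toSet, g x ≤ ∫⁻ x, g x := by
  have := countable_of_pairwiseDisjoint h𝒬
  rw [← lintegral_iUnion (fun Q : 𝒬 => Q.1.measurableSet_toSet)
    (fun Q R hQR => h𝒬 Q.2 R.2 (Subtype.coe_ne_coe.2 hQR))]
  exact setLIntegral_le_lintegral _ _

end Cube

lemma lintegral_one_add_norm_lt_top (n : ℕ) :
    ∫⁻ x : Rn n, ENNReal.ofReal ((1 + ‖x‖) ^ (-((n : ℝ) + 1))) < ∞ :=
  finite_integral_one_add_norm (by simp)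

section Modular

variable {n : ℕ} {p : Rn n → ℝ}

lemma eModular_ofExp (hp : ∀ x, 0 < p x) (μ : Measure (Rn n)) (f : Rn n → ℝ≥0∞) (lam : ℝ≥0∞) :
    eModular (ofExp p) μ f lam = ∫⁻ x, (f x / lam) ^ p x ∂μ := by
  simp [eModular, ofExp, ENNReal.toReal_ofReal (hp _).le]

lemma eModular_indicator (hp : ∀ x, 0 < p x) (Q : Cube n) (f : Rn n → ℝ) (lam : ℝ≥0∞) :
    eModular (ofExp p) volume (fun x => ENNReal.ofReal |Q.toSet.indicator f x|) lam =
      ∫⁻ x in Q.toSet, (ENNReal.ofReal |f x| / lam) ^ p x := by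
  rw [eModular_ofExp hp, ← lintegral_indicator Q.measurableSet_toSet]
  congr 1 with x
  by_cases hx : x ∈ Q.toSet <;> simp [hx, hp x]

lemma eModular_le_one_of_eNorm_lt (hp : ∀ x, 0 < p x) {μ : Measure (Rn n)} {f : Rn n → ℝ≥0∞}
    {lam : ℝ≥0∞} (h : eNorm (ofExp p) μ f < lam) : eModular (ofExp p) μ f lam ≤ 1 := by
  obtain ⟨l, ⟨-, hl⟩, hlt⟩ := sInf_lt_iff.1 h
  refine le_trans ?_ hl
  rw [eModular_ofExp hp, eModular_ofExp hp]
  gcongr with x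
  exact (hp x).le

lemma one_lt_eModular_of_lt_eNorm {μ : Measure (Rn n)} {f : Rn n → ℝ≥0∞}
    {lam : ℝ≥0∞} (h0 : lam ≠ 0) (h : lam < eNorm (ofExp p) μ f) :
    1 < eModular (ofExp p) μ f lam := by
  by_contra! h1
  exact h.not_ge (sInf_le ⟨h0, h1⟩)

lemma vNorm_indicator_le (hp : ∀ x, 0 < p x) (Q : Cube n) (f : Rn n → ℝ) :
    vNorm (ofExp p) (Q.toSet.indicator f) ≤ vNorm (ofExp p) f := by
  refine le_sInf fun l hl => sInf_le ⟨hl.1, le_trans ?_ hl.2⟩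
  rw [eModular_indicator hp, eModular_ofExp hp]
  exact setLIntegral_le_lintegral _ _

lemma eNorm_zero (hp : ∀ x, 0 < p x) (μ : Measure (Rn n)) : eNorm (ofExp p) μ (fun _ => 0) = 0 := by
  refine le_antisymm (le_of_forall_gt fun l hl => ?_) bot_le
  obtain ⟨m, hm0, hml⟩ := exists_between hl
  refine lt_of_le_of_lt (sInf_le ⟨hm0.ne', ?_⟩) hml
  simp [eModular_ofExp hp, hp]

lemma vNorm_indicator_one_ne_zero (hp : ∀ x, 1 / 2 ≤ p x) (Q : Cube n) :
    vNorm (ofExp p) (Q.toSet.indicator fun _ => (1 : ℝ)) ≠ 0 := by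
  have hp0 : ∀ x, 0 < p x := fun x => lt_of_lt_of_le (by norm_num) (hp x)
  intro h
  have key : ∀ l : ℝ≥0∞, 0 < l → l ≤ 1 → volume Q.toSet ≤ l ^ (1 / 2 : ℝ) := by
    intro l hl hl1
    have h1 := eModular_le_one_of_eNorm_lt hp0 (h.trans_lt hl)
    rw [eModular_indicator hp0] at h1
    have h2 : (l⁻¹) ^ (1 / 2 : ℝ) * volume Q.toSet ≤ 1 := by
      rw [← setLIntegral_const]
      refine le_trans (setLIntegral_mono' Q.measurableSet_toSet fun x _ => ?_) h1
      simpa using ENNReal.rpow_le_rpow_of_exponent_le (ENNReal.one_le_inv.2 hl1) (hp x)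
    rw [ENNReal.inv_rpow, mul_comm, ← div_eq_mul_inv] at h2
    have h3 : l ^ (1 / 2 : ℝ) ≠ 0 := by simp [ENNReal.rpow_eq_zero_iff, hl.ne']
    have h4 : l ^ (1 / 2 : ℝ) ≠ ∞ :=
      ENNReal.rpow_ne_top_of_nonneg (by norm_num) (hl1.trans_lt one_lt_top).ne
    simpa using (ENNReal.div_le_iff h3 h4).1 h2
  have hlt : 0 < min 1 (volume Q.toSet) := lt_min one_pos Q.volume_toSet_pos
  obtain ⟨m, hm0, hm⟩ := exists_between hlt
  have hm1 : m < 1 := hm.trans_le (min_le_left _ _)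
  have h5 := key (m ^ (2 : ℝ)) (ENNReal.rpow_pos hm0 hm1.ne_top)
    (ENNReal.rpow_le_one hm1.le (by norm_num))
  rw [← ENNReal.rpow_mul] at h5
  norm_num at h5
  exact (hm.trans_le (min_le_right _ _)).not_ge h5

lemma setLIntegral_inv_vNorm_indicator_one_le {P : ℝ} (hp : ∀ x, 1 / 2 ≤ p x) (hP : ∀ x, p x ≤ P)
    (Q : Cube n) :
    ∫⁻ x in Q.toSet, (vNorm (ofExp p) (Q.toSet.indicator fun _ => (1 : ℝ)))⁻¹ ^ p x ≤
      2 ^ P := by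
  have hp0 : ∀ x, 0 < p x := fun x => lt_of_lt_of_le (by norm_num) (hp x)
  have hs := vNorm_indicator_one_ne_zero hp Q
  set s := vNorm (ofExp p) (Q.toSet.indicator fun _ => (1 : ℝ)) with hsdef
  rcases eq_or_ne s ∞ with hst | hst
  · simp [hst, hp0]
  have hlt : s < 2 * s := by
    rw [two_mul]; exact ENNReal.lt_add_right hst hs
  have h1 := eModular_le_one_of_eNorm_lt hp0 hlt
  rw [eModular_indicator hp0] at h1
  calc ∫⁻ x in Q.toSet, s⁻¹ ^ p x
      ≤ ∫⁻ x in Q.toSet, 2 ^ P * (ENNReal.ofReal |(1 : ℝ)| / (2 * s)) ^ p x := by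
        refine lintegral_mono fun x => ?_
        have h2 : s⁻¹ = 2 * (ENNReal.ofReal |(1 : ℝ)| / (2 * s)) := by
          rw [abs_one, ENNReal.ofReal_one, one_div, ENNReal.mul_inv (by simp) (by simp), ← mul_assoc,
            ENNReal.mul_inv_cancel (by simp) (by simp), one_mul]
        simp only
        conv_lhs => rw [h2, ENNReal.mul_rpow_of_nonneg _ _ (hp0 x).le]
        gcongr
        · norm_num
        · exact hP x
    _ ≤ 2 ^ P * 1 := by
        rw [lintegral_const_mul' _ _ (by simp [ENNReal.rpow_eq_top_iff])]
        gcongr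
    _ = 2 ^ P := mul_one _

end Modular

lemma mul_rpow_le_add_rpow {a b : ℝ≥0∞} {q q₁ q₂ : ℝ} (h₁ : 0 < q₁) (h₂ : 0 < q₂)
    (h : 1 / q = 1 / q₁ + 1 / q₂) : (a * b) ^ q ≤ a ^ q₁ + b ^ q₂ := by
  have hq : 0 < q := one_div_pos.1 (h ▸ by positivity)
  set u := a ^ q₁ + b ^ q₂ with hu
  have ha : a ≤ u ^ (1 / q₁) := by
    rw [one_div, ENNReal.le_rpow_inv_iff h₁]; exact le_self_add
  have hb : b ≤ u ^ (1 / q₂) := by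
    rw [one_div, ENNReal.le_rpow_inv_iff h₂]; exact le_add_self
  rw [← ENNReal.le_rpow_inv_iff hq, ← one_div, h,
    ENNReal.rpow_add_of_nonneg _ _ (by positivity) (by positivity)]
  exact mul_le_mul' ha hb

section LogHolder

variable {n : ℕ} {p : Rn n → ℝ}

lemma LH0.continuous_inv (h : LH0 p) : Continuous fun x => 1 / p x := by
  obtain ⟨C, hC, h⟩ := h
  refine Metric.continuous_iff.2 fun y ε hε => ?_
  refine ⟨min (1 / 2) (Real.exp (-(C / ε))), by positivity, fun x hx => ?_⟩
  rw [lt_min_iff] at hx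
  rcases eq_or_ne x y with rfl | hxy
  · simpa using hε
  have hd : 0 < dist x y := dist_pos.2 hxy
  rw [Real.dist_eq]
  have h1 : Real.log (dist x y) < -(C / ε) := (Real.log_lt_iff_lt_exp hd).2 hx.2
  have h2 : C / ε < -Real.log (dist x y) := by linarith
  have h3 : 0 < -Real.log (dist x y) := (by positivity : 0 < C / ε).trans h2
  refine (h x y hx.1).trans_lt ((div_lt_iff₀ h3).2 ?_)
  rw [mul_comm]
  exact (div_lt_iff₀ hε).1 h2

lemma LH.exists_le (hp : ∀ x, 0 < p x) (h : LH p) : ∃ P, 0 < P ∧ ∀ x, p x ≤ P := by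
  obtain ⟨h0, q, hq, C, hC, hinf⟩ := h
  obtain ⟨m, hm, hball⟩ : ∃ m > 0, ∀ x ∈ Metric.closedBall (0 : Rn n) (Real.exp (2 * q * C)),
      m ≤ 1 / p x := by
    obtain ⟨x₀, -, hx₀⟩ := (isCompact_closedBall (0 : Rn n) (Real.exp (2 * q * C))).exists_isMinOn
      ⟨0, by simp [Real.exp_nonneg]⟩ h0.continuous_inv.continuousOn
    exact ⟨1 / p x₀, one_div_pos.2 (hp x₀), fun x hx => hx₀ hx⟩
  have hlow : ∀ x, min m (1 / (2 * q)) ≤ 1 / p x := by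
    intro x
    by_cases hx : x ∈ Metric.closedBall (0 : Rn n) (Real.exp (2 * q * C))
    · exact (min_le_left _ _).trans (hball x hx)
    refine (min_le_right _ _).trans ?_
    simp only [mem_closedBall_zero_iff, not_le] at hx
    have h1 : 2 * q * C ≤ Real.log (Real.exp 1 + ‖x‖) := by
      rw [Real.le_log_iff_exp_le (by positivity)]
      linarith [Real.exp_pos 1]
    have h2 : C / Real.log (Real.exp 1 + ‖x‖) ≤ 1 / (2 * q) := by
      rw [div_le_div_iff₀ (lt_of_lt_of_le (by positivity) h1) (by positivity)]
      linarith
    have h3 := (abs_le.1 ((hinf x).trans h2)).1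
    have h4 : 1 / q = 1 / (2 * q) + 1 / (2 * q) := by field_simp; norm_num
    linarith
  have hmin : 0 < min m (1 / (2 * q)) := lt_min hm (by positivity)
  refine ⟨1 / min m (1 / (2 * q)), by positivity, fun x => ?_⟩
  exact (le_one_div hmin (hp x)).1 (hlow x)

/-- The oscillation of the reciprocal of a log-Hölder exponent on a cube is controlled by the
logarithm of the mass bounds of the cube. -/
lemma LH.abs_sub_inv_mul_le (hp : ∀ x, 1 ≤ p x) (h : LH p) :
    ∃ D, 0 ≤ D ∧ ∀ (Q : Cube n), ∀ x ∈ Q.toSet, ∀ y ∈ Q.toSet, ∃ z ∈ Q.toSet,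
      |1 / p x - 1 / p y| *
        (n * (-Real.log (min 1 Q.side)) + (n + 1) * Real.log (Real.exp 1 + ‖z‖)) ≤ D := by
  obtain ⟨⟨C₀, hC₀, h0⟩, q, hq, C, hC, hinf⟩ := h
  have hlog : ∀ x : Rn n, 1 ≤ Real.log (Real.exp 1 + ‖x‖) := fun x => by
    rw [Real.le_log_iff_exp_le (by positivity)]
    linarith [norm_nonneg x]
  have hloc : ∀ (Q : Cube n), ∀ x ∈ Q.toSet, ∀ y ∈ Q.toSet,
      |1 / p x - 1 / p y| * (-Real.log (min 1 Q.side)) ≤ C₀ + 1 := by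
    intro Q x hx y hy
    have hℓ : 0 < min 1 Q.side := lt_min one_pos Q.side_pos
    have hnn : 0 ≤ -Real.log (min 1 Q.side) := by
      linarith [Real.log_nonpos hℓ.le (min_le_left _ _)]
    rcases lt_or_ge (min 1 Q.side) (1 / 2) with hs | hs
    · have hside : min 1 Q.side = Q.side := by
        rcases min_choice 1 Q.side with h | h
        · rw [h] at hs; norm_num at hs
        · exact h
      rw [hside] at hs hnn ⊢
      have hd := Q.dist_le_side hx hy
      rcases eq_or_ne x y with rfl | hxy
      · simp; positivity
      have hdpos : 0 < dist x y := dist_pos.2 hxy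
      have h1 : -Real.log Q.side ≤ -Real.log (dist x y) :=
        neg_le_neg (Real.log_le_log hdpos hd)
      have h2 : 0 < -Real.log (dist x y) := by
        linarith [Real.log_neg hdpos (by linarith)]
      calc |1 / p x - 1 / p y| * (-Real.log Q.side)
          ≤ C₀ / (-Real.log (dist x y)) * (-Real.log (dist x y)) := by
            gcongr
            exact h0 x y (by linarith)
        _ = C₀ := div_mul_cancel₀ _ h2.ne'
        _ ≤ C₀ + 1 := by linarith
    · have h1 : |1 / p x - 1 / p y| ≤ 1 := by
        have hx0 : 0 < 1 / p x := one_div_pos.2 (by linarith [hp x])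
        have hy0 : 0 < 1 / p y := one_div_pos.2 (by linarith [hp y])
        have hx1 : 1 / p x ≤ 1 := (div_le_one (by linarith [hp x])).2 (hp x)
        have hy1 : 1 / p y ≤ 1 := (div_le_one (by linarith [hp y])).2 (hp y)
        rw [abs_le]; constructor <;> linarith
      have h2 : -Real.log (min 1 Q.side) ≤ 1 := by
        have := Real.log_le_log (by norm_num) hs
        rw [one_div, Real.log_inv] at this
        linarith [Real.log_two_lt_d9]
      nlinarith [abs_nonneg (1 / p x - 1 / p y)]
  have hfar : ∀ x y : Rn n, ‖x‖ ≤ ‖y‖ →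
      |1 / p x - 1 / p y| * Real.log (Real.exp 1 + ‖x‖) ≤ 2 * C := by
    intro x y hxy
    have hx := hlog x
    have hxy' : Real.log (Real.exp 1 + ‖x‖) ≤ Real.log (Real.exp 1 + ‖y‖) :=
      Real.log_le_log (by positivity) (by linarith)
    rw [← le_div_iff₀ (by linarith)]
    calc |1 / p x - 1 / p y| ≤ |1 / p x - 1 / q| + |1 / q - 1 / p y| := abs_sub_le _ _ _
      _ ≤ C / Real.log (Real.exp 1 + ‖x‖) + C / Real.log (Real.exp 1 + ‖x‖) := by
        refine add_le_add (hinf x) ?_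
        rw [abs_sub_comm]
        refine (hinf y).trans ?_
        gcongr
      _ = 2 * C / Real.log (Real.exp 1 + ‖x‖) := by ring
  refine ⟨n * (C₀ + 1) + (n + 1) * (2 * C), by positivity, fun Q x hx y hy => ?_⟩
  obtain ⟨z, hz, hzle⟩ : ∃ z ∈ Q.toSet,
      |1 / p x - 1 / p y| * Real.log (Real.exp 1 + ‖z‖) ≤ 2 * C := by
    rcases le_total ‖x‖ ‖y‖ with hxy | hxy
    · exact ⟨x, hx, hfar x y hxy⟩
    · exact ⟨y, hy, abs_sub_comm (1 / p x) _ ▸ hfar y x hxy⟩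
  refine ⟨z, hz, ?_⟩
  calc _ = n * (|1 / p x - 1 / p y| * (-Real.log (min 1 Q.side))) +
        (n + 1) * (|1 / p x - 1 / p y| * Real.log (Real.exp 1 + ‖z‖)) := by ring
    _ ≤ _ := by
      gcongr
      exact hloc Q x hx y hy

/-- Powers of numbers above the tail mass of a cube have comparable values for all values of a
log-Hölder exponent on the cube. -/
lemma LH.exists_rpow_le_mul_rpow (hp : ∀ x, 1 ≤ p x) (h : LH p) :
    ∃ M : ℝ≥0∞, M ≠ ∞ ∧ ∀ (Q : Cube n), ∀ x ∈ Q.toSet, ∀ y ∈ Q.toSet, ∀ t : ℝ≥0∞,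
      Q.tailMass ≤ t → t ≤ 1 → t ^ p x ≤ M * t ^ p y := by
  have hp0 : ∀ x, 0 < p x := fun x => one_pos.trans_le (hp x)
  obtain ⟨P, hP0, hP⟩ := h.exists_le hp0
  obtain ⟨D, hD, hosc⟩ := h.abs_sub_inv_mul_le hp
  refine ⟨ENNReal.ofReal (Real.exp (P ^ 2 * D)), ofReal_ne_top, fun Q x hx y hy t hQt ht1 => ?_⟩
  lift t to NNReal using (ht1.trans_lt one_lt_top).ne
  obtain ⟨z, hz, hzD⟩ := hosc Q x hx y hy
  have hℓ : 0 < min 1 Q.side := lt_min one_pos Q.side_pos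
  have hle := (Q.le_tailMass hz).trans hQt
  rw [ENNReal.ofReal_le_coe] at hle
  have hpos : 0 < (min 1 Q.side) ^ n * (Real.exp 1 + ‖z‖) ^ (-((n : ℝ) + 1)) := by positivity
  have ht0 : 0 < (t : ℝ) := hpos.trans_le hle
  have ht1' : (t : ℝ) ≤ 1 := by exact_mod_cast ht1
  have hlogt : -Real.log t ≤
      n * (-Real.log (min 1 Q.side)) + (n + 1) * Real.log (Real.exp 1 + ‖z‖) := by
    have := Real.log_le_log hpos hle
    rw [Real.log_mul (by positivity) (by positivity), Real.log_pow,
      Real.log_rpow (by positivity)] at this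
    linarith
  have hlogt0 : 0 ≤ -Real.log t := by linarith [Real.log_nonpos ht0.le ht1']
  have hdiff : |p x - p y| ≤ P ^ 2 * |1 / p x - 1 / p y| := by
    have h1 : p x - p y = -(p x * p y * (1 / p x - 1 / p y)) := by
      have := (hp0 x).ne'
      have := (hp0 y).ne'
      field_simp
      ring
    rw [h1, abs_neg, abs_mul, abs_of_pos (mul_pos (hp0 x) (hp0 y)), pow_two]
    gcongr
    · exact (hp0 y).le
    · exact hP x
    · exact hP y
  have hexp : (p x - p y) * Real.log t ≤ P ^ 2 * D := by
    calc (p x - p y) * Real.log t = -(p x - p y) * (-Real.log t) := by ring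
      _ ≤ |p x - p y| * (-Real.log t) := by
        gcongr
        exact neg_le_abs _
      _ ≤ P ^ 2 * |1 / p x - 1 / p y| *
          (n * (-Real.log (min 1 Q.side)) + (n + 1) * Real.log (Real.exp 1 + ‖z‖)) := by
        gcongr
      _ ≤ P ^ 2 * D := by
        rw [mul_assoc]
        gcongr
  have hreal : (t : ℝ) ^ p x ≤ Real.exp (P ^ 2 * D) * (t : ℝ) ^ p y := by
    rw [Real.rpow_def_of_pos ht0, Real.rpow_def_of_pos ht0, ← Real.exp_add, Real.exp_le_exp]
    linarith
  have := ENNReal.ofReal_le_ofReal hreal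
  rwa [ENNReal.ofReal_mul (Real.exp_nonneg _), ← ENNReal.ofReal_rpow_of_pos ht0,
    ← ENNReal.ofReal_rpow_of_pos ht0, ENNReal.ofReal_coe_nnreal] at this

/-- The normalized local norm of a function on a cube, raised to the exponent, is controlled by the
local modular and the tail mass. -/
lemma LH.exists_rpow_vNorm_le (hp : ∀ x, 1 ≤ p x) (h : LH p) :
    ∃ M : ℝ≥0∞, M ≠ ∞ ∧ ∀ (Q : Cube n) (f : Rn n → ℝ) (A : ℝ≥0∞), A ≠ 0 → A ≠ ∞ →
      vNorm (ofExp p) f ≤ A → ∀ x ∈ Q.toSet,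
        (vNorm (ofExp p) (Q.toSet.indicator f) / A) ^ p x ≤
          M * (∫⁻ y in Q.toSet, (ENNReal.ofReal |f y| / A) ^ p y) + Q.tailMass := by
  have hp0 : ∀ x, 0 < p x := fun x => one_pos.trans_le (hp x)
  obtain ⟨P, hP0, hP⟩ := h.exists_le hp0
  obtain ⟨M, hM, hcomp⟩ := h.exists_rpow_le_mul_rpow hp
  refine ⟨M * 2 ^ P, by finiteness, fun Q f A hA0 hA hfA x hx => ?_⟩
  have hTA := (vNorm_indicator_le hp0 Q f).trans hfA
  set T := vNorm (ofExp p) (Q.toSet.indicator f) with hT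
  have ht1 : T / A ≤ 1 := ENNReal.div_le_of_le_mul (by simpa using hTA)
  rcases lt_or_ge (T / A) Q.tailMass with hlt | hge
  · refine le_add_left ?_
    refine le_trans ?_ hlt.le
    simpa using ENNReal.rpow_le_rpow_of_exponent_ge ht1 (hp x)
  refine le_add_right ?_
  rcases eq_or_ne T 0 with hT0 | hT0
  · simp [hT0, hp0]
  have hTtop : T ≠ ∞ := (hTA.trans_lt hA.lt_top).ne
  have h1 : 1 < ∫⁻ y in Q.toSet, (ENNReal.ofReal |f y| / (T / 2)) ^ p y := by
    rw [← eModular_indicator hp0]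
    exact one_lt_eModular_of_lt_eNorm (by simp [hT0]) (ENNReal.half_lt_self hT0 hTtop)
  have htpow : (T / A) ^ p x ≠ ∞ :=
    ENNReal.rpow_ne_top_of_nonneg (hp0 x).le (ht1.trans_lt one_lt_top).ne
  calc (T / A) ^ p x
      ≤ (T / A) ^ p x * ∫⁻ y in Q.toSet, (ENNReal.ofReal |f y| / (T / 2)) ^ p y :=
        le_mul_of_one_le_right' h1.le
    _ = ∫⁻ y in Q.toSet, (T / A) ^ p x * (ENNReal.ofReal |f y| / (T / 2)) ^ p y :=
        (lintegral_const_mul' _ _ htpow).symm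
    _ ≤ ∫⁻ y in Q.toSet, M * 2 ^ P * (ENNReal.ofReal |f y| / A) ^ p y := by
        refine setLIntegral_mono' Q.measurableSet_toSet fun y hy => ?_
        have h2 : T / A * (ENNReal.ofReal |f y| / (T / 2)) = 2 * (ENNReal.ofReal |f y| / A) := by
          have h3 : (T / 2)⁻¹ = 2 * T⁻¹ := by
            rw [ENNReal.inv_div (by simp) (by simp), div_eq_mul_inv]
          rw [div_eq_mul_inv (ENNReal.ofReal _) (T / 2), h3]
          calc T / A * (ENNReal.ofReal |f y| * (2 * T⁻¹))
              = T * T⁻¹ * (2 * (ENNReal.ofReal |f y| / A)) := by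
                simp only [div_eq_mul_inv]; ring
            _ = _ := by rw [ENNReal.mul_inv_cancel hT0 hTtop, one_mul]
        calc (T / A) ^ p x * (ENNReal.ofReal |f y| / (T / 2)) ^ p y
            ≤ M * (T / A) ^ p y * (ENNReal.ofReal |f y| / (T / 2)) ^ p y := by
              gcongr
              exact hcomp Q x hx y hy _ hge ht1
          _ = M * 2 ^ p y * (ENNReal.ofReal |f y| / A) ^ p y := by
              rw [mul_assoc, ← ENNReal.mul_rpow_of_nonneg _ _ (hp0 y).le, h2,
                ENNReal.mul_rpow_of_nonneg _ _ (hp0 y).le, mul_assoc]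
          _ ≤ _ := by
              gcongr
              · norm_num
              · exact hP y
    _ = _ := lintegral_const_mul' _ _ (by finiteness)

end LogHolder

/-- uniform boundedness of the bilinear `p(·)`-averaging operators
`T⃗_{p⃗(·),𝒬}` over disjoint families of cubes. -/
theorem statement7 {n : ℕ} (p₁ p₂ p : Rn n → ℝ)
    (hp₁m : Measurable p₁) (hp₂m : Measurable p₂)
    (hp₁1 : ∀ x, 1 ≤ p₁ x) (hp₂1 : ∀ x, 1 ≤ p₂ x)
    (hp₁LH : LH p₁) (hp₂LH : LH p₂)
    (hp : ∀ x, 1 / p x = 1 / p₁ x + 1 / p₂ x) :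
    ∃ C : ℝ≥0∞, C ≠ ∞ ∧ ∀ 𝒬 : Set (Cube n),
      𝒬.PairwiseDisjoint (fun Q => Q.toSet) →
      ∀ f₁ f₂ : Rn n → ℝ, Measurable f₁ → Measurable f₂ →
        vNorm (ofExp p₁) f₁ ≠ ∞ → vNorm (ofExp p₂) f₂ ≠ ∞ →
        eNorm (ofExp p) volume
            (fun x => ∑' Q : 𝒬,
              (Q : Cube n).toSet.indicator
                (fun _ =>
                  vNorm (ofExp p₁) ((Q : Cube n).toSet.indicator f₁) *
                    vNorm (ofExp p₂) ((Q : Cube n).toSet.indicator f₂) /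
                      vNorm (ofExp p) ((Q : Cube n).toSet.indicator fun _ => (1 : ℝ))) x) ≤
          C * vNorm (ofExp p₁) f₁ * vNorm (ofExp p₂) f₂ := by
  have hp₁0 : ∀ x, 0 < p₁ x := fun x => one_pos.trans_le (hp₁1 x)
  have hp₂0 : ∀ x, 0 < p₂ x := fun x => one_pos.trans_le (hp₂1 x)
  have hinv : ∀ x, 0 < 1 / p x := fun x => by
    rw [hp]; exact add_pos (one_div_pos.2 (hp₁0 x)) (one_div_pos.2 (hp₂0 x))
  have hp0 : ∀ x, 0 < p x := fun x => one_div_pos.1 (hinv x)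
  have hphalf : ∀ x, 1 / 2 ≤ p x := fun x => by
    rw [one_div_le (by norm_num) (hp0 x), hp]
    linarith [(div_le_one (hp₁0 x)).2 (hp₁1 x), (div_le_one (hp₂0 x)).2 (hp₂1 x)]
  obtain ⟨P, -, hP₁⟩ := hp₁LH.exists_le hp₁0
  have hP : ∀ x, p x ≤ P := fun x => by
    refine le_trans ((one_div_le_one_div (hp₁0 x) (hp0 x)).1 ?_) (hP₁ x)
    rw [hp]
    exact le_add_of_nonneg_right (one_div_pos.2 (hp₂0 x)).le
  obtain ⟨M₁, hM₁, hloc₁⟩ := hp₁LH.exists_rpow_vNorm_le hp₁1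
  obtain ⟨M₂, hM₂, hloc₂⟩ := hp₂LH.exists_rpow_vNorm_le hp₂1
  have hH := lintegral_one_add_norm_lt_top n
  set H := ∫⁻ x : Rn n, ENNReal.ofReal ((1 + ‖x‖) ^ (-((n : ℝ) + 1))) with hHdef
  set W := M₁ + H + (M₂ + H) with hW
  set K := 2 ^ P * W + 1 with hK
  have hWtop : W ≠ ∞ := by finiteness
  have hK0 : K ≠ 0 := by simp [hK]
  have hKtop : K ≠ ∞ := by finiteness
  have hK1 : 1 ≤ K := le_add_self
  refine ⟨K ^ 2 * 4, by finiteness, fun 𝒬 h𝒬 f₁ f₂ _ _ hf₁ hf₂ => ?_⟩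
  have hcount := Cube.countable_of_pairwiseDisjoint h𝒬
  by_cases hzero : vNorm (ofExp p₁) f₁ = 0 ∨ vNorm (ofExp p₂) f₂ = 0
  · refine le_trans (le_of_eq ?_) zero_le
    convert eNorm_zero hp0 volume using 2
    ext x
    refine ENNReal.tsum_eq_zero.2 fun Q => ?_
    have hprod : vNorm (ofExp p₁) ((Q : Cube n).toSet.indicator f₁) *
        vNorm (ofExp p₂) ((Q : Cube n).toSet.indicator f₂) = 0 := by
      rcases hzero with h | h
      · simp [le_zero_iff.1 ((vNorm_indicator_le hp₁0 Q.1 f₁).trans h.le)]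
      · simp [le_zero_iff.1 ((vNorm_indicator_le hp₂0 Q.1 f₂).trans h.le)]
    simp [hprod]
  push Not at hzero
  obtain ⟨hA0, hB0⟩ := hzero
  set A := 2 * vNorm (ofExp p₁) f₁ with hA
  set B := 2 * vNorm (ofExp p₂) f₂ with hB
  have hA0' : A ≠ 0 := by simp [hA, hA0]
  have hB0' : B ≠ 0 := by simp [hB, hB0]
  have hAtop : A ≠ ∞ := by finiteness
  have hBtop : B ≠ ∞ := by finiteness
  have hltA : vNorm (ofExp p₁) f₁ < A := by
    rw [hA, two_mul]; exact ENNReal.lt_add_right hf₁ hA0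
  have hltB : vNorm (ofExp p₂) f₂ < B := by
    rw [hB, two_mul]; exact ENNReal.lt_add_right hf₂ hB0
  have hmod₁ := eModular_le_one_of_eNorm_lt hp₁0 hltA
  have hmod₂ := eModular_le_one_of_eNorm_lt hp₂0 hltB
  rw [eModular_ofExp hp₁0] at hmod₁
  rw [eModular_ofExp hp₂0] at hmod₂
  set D : Cube n → ℝ≥0∞ := fun Q =>
    M₁ * (∫⁻ y in Q.toSet, (ENNReal.ofReal |f₁ y| / A) ^ p₁ y) + Q.tailMass +
      (M₂ * (∫⁻ y in Q.toSet, (ENNReal.ofReal |f₂ y| / B) ^ p₂ y) + Q.tailMass) with hD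
  have hDsum : ∑' Q : 𝒬, D Q ≤ W := by
    simp only [hD, hW, ENNReal.tsum_add, ENNReal.tsum_mul_left]
    have htail : ∑' Q : 𝒬, (Q : Cube n).tailMass ≤ H := Cube.tsum_setLIntegral_le h𝒬 _
    gcongr
    · exact mul_le_of_le_one_right' ((Cube.tsum_setLIntegral_le h𝒬 _).trans hmod₁)
    · exact mul_le_of_le_one_right' ((Cube.tsum_setLIntegral_le h𝒬 _).trans hmod₂)
  have hDtop : ∀ Q : 𝒬, D Q ≠ ∞ := fun Q =>
    (((ENNReal.le_tsum Q).trans hDsum).trans_lt hWtop.lt_top).ne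
  refine sInf_le_of_le (b := K ^ 2 * (A * B)) ⟨by simp [hK0, hA0', hB0'], ?_⟩ (le_of_eq ?_)
  swap
  · rw [hA, hB]; ring
  rw [eModular_ofExp hp0]
  set s : Cube n → ℝ≥0∞ := fun Q => vNorm (ofExp p) (Q.toSet.indicator fun _ => (1 : ℝ)) with hs
  set F : Rn n → ℝ≥0∞ := fun x => ∑' Q : 𝒬, (Q : Cube n).toSet.indicator
    (fun _ => vNorm (ofExp p₁) ((Q : Cube n).toSet.indicator f₁) *
      vNorm (ofExp p₂) ((Q : Cube n).toSet.indicator f₂) / s Q) x with hF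
  have hFQ : ∀ Q : 𝒬, ∀ x ∈ (Q : Cube n).toSet,
      (F x / (K ^ 2 * (A * B))) ^ p x ≤ D Q * K⁻¹ * (s Q)⁻¹ ^ p x := by
    intro Q x hx
    have hFx : F x = vNorm (ofExp p₁) ((Q : Cube n).toSet.indicator f₁) *
        vNorm (ofExp p₂) ((Q : Cube n).toSet.indicator f₂) / s Q := by
      simp only [hF]
      rw [tsum_eq_single Q, indicator_of_mem hx]
      intro R hRQ
      refine indicator_of_notMem (fun hxR => ?_) _
      exact Set.disjoint_left.1 (h𝒬 R.2 Q.2 (Subtype.coe_ne_coe.2 hRQ)) hxR hx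
    have hsplit : F x / (K ^ 2 * (A * B)) =
        vNorm (ofExp p₁) ((Q : Cube n).toSet.indicator f₁) / A *
          (vNorm (ofExp p₂) ((Q : Cube n).toSet.indicator f₂) / B) * (K ^ 2)⁻¹ * (s Q)⁻¹ := by
      rw [hFx, div_eq_mul_inv _ (K ^ 2 * (A * B)),
        ENNReal.mul_inv (Or.inl (pow_ne_zero 2 hK0)) (Or.inl (by finiteness)),
        ENNReal.mul_inv (Or.inl hA0') (Or.inl hAtop)]
      simp only [div_eq_mul_inv]
      ring
    have hKpow : ((K ^ 2)⁻¹) ^ p x ≤ K⁻¹ := by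
      calc ((K ^ 2)⁻¹) ^ p x ≤ ((K ^ 2)⁻¹) ^ (1 / 2 : ℝ) :=
            ENNReal.rpow_le_rpow_of_exponent_ge (ENNReal.inv_le_one.2 (one_le_pow₀ hK1)) (hphalf x)
        _ = K⁻¹ := by
            rw [ENNReal.inv_rpow, ← ENNReal.rpow_natCast, ← ENNReal.rpow_mul]
            norm_num
    rw [hsplit, ENNReal.mul_rpow_of_nonneg _ _ (hp0 x).le, ENNReal.mul_rpow_of_nonneg _ _ (hp0 x).le]
    gcongr
    refine (mul_rpow_le_add_rpow (hp₁0 x) (hp₂0 x) (hp x)).trans (add_le_add ?_ ?_)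
    · exact hloc₁ Q f₁ A hA0' hAtop hltA.le x hx
    · exact hloc₂ Q f₂ B hB0' hBtop hltB.le x hx
  have hsupp : ∀ x, x ∉ ⋃ Q : 𝒬, (Q : Cube n).toSet → (F x / (K ^ 2 * (A * B))) ^ p x = 0 := by
    intro x hx
    have hFx : F x = 0 := ENNReal.tsum_eq_zero.2 fun Q =>
      indicator_of_notMem (fun hxQ => hx (mem_iUnion.2 ⟨Q, hxQ⟩)) _
    simp [hFx, hp0 x]
  calc ∫⁻ x, (F x / (K ^ 2 * (A * B))) ^ p x
      = ∫⁻ x in ⋃ Q : 𝒬, (Q : Cube n).toSet, (F x / (K ^ 2 * (A * B))) ^ p x := by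
        rw [← lintegral_indicator (MeasurableSet.iUnion fun Q : 𝒬 => Q.1.measurableSet_toSet)]
        congr 1 with x
        by_cases hx : x ∈ ⋃ Q : 𝒬, (Q : Cube n).toSet
        · rw [indicator_of_mem hx]
        · rw [indicator_of_notMem hx, hsupp x hx]
    _ = ∑' Q : 𝒬, ∫⁻ x in (Q : Cube n).toSet, (F x / (K ^ 2 * (A * B))) ^ p x :=
        lintegral_iUnion (fun Q : 𝒬 => Q.1.measurableSet_toSet)
          (fun Q R hQR => h𝒬 Q.2 R.2 (Subtype.coe_ne_coe.2 hQR)) _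
    _ ≤ ∑' Q : 𝒬, D Q * (K⁻¹ * 2 ^ P) := by
        refine ENNReal.tsum_le_tsum fun Q => ?_
        refine (setLIntegral_mono' Q.1.measurableSet_toSet (hFQ Q)).trans ?_
        rw [lintegral_const_mul' _ _ (ENNReal.mul_ne_top (hDtop Q) (ENNReal.inv_ne_top.2 hK0)),
          mul_assoc]
        gcongr
        exact setLIntegral_inv_vNorm_indicator_one_le hphalf hP Q
    _ ≤ W * (K⁻¹ * 2 ^ P) := by
        rw [ENNReal.tsum_mul_right]
        gcongr
    _ = 2 ^ P * W / K := by rw [div_eq_mul_inv]; ring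
    _ ≤ 1 := ENNReal.div_le_of_le_mul (by rw [one_mul]; exact le_self_add)
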